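/- arXiv:1701.00151 — 13 statements merged into one kernel-verified Lean document; each statement's English description precedes it below -/
import Mathlib

section
/- Let R be a commutative domain, I an injective R-module, and ι : R → I an injective R-linear map. Then for every R-module A, the kernel of the R-linear map A → A ⊗[R] I sending a to a ⊗ ι(1) equals the classical torsion submodule of A, i.e., the submodule of elements a ∈ A annihilated by some nonzero element of R. -/
open scoped nonZeroDivisors in
/-- An element of a module over a domain that is not torsion is detected by a linear functional
with values in the fraction field. -/
theorem exists_linearMap_fractionRing_ne_zero {R : Type*} [CommRing R] [IsDomain R]
    {M : Type*} [AddCommGroup M] [Module R M] (m : M) (hm : ∀ r : R, r ≠ 0 → r • m ≠ 0) :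
    ∃ φ : M →ₗ[R] FractionRing R, φ m ≠ 0 := by
  have hne : LocalizedModule.mkLinearMap R⁰ M m ≠ 0 := fun h ↦ by
    obtain ⟨c, hc⟩ := (IsLocalizedModule.eq_zero_iff R⁰ (LocalizedModule.mkLinearMap R⁰ M)).1 h
    exact hm c (nonZeroDivisors.ne_zero c.2) hc
  obtain ⟨f, hf⟩ : ∃ f : Module.Dual (FractionRing R) (LocalizedModule R⁰ M),
      f (LocalizedModule.mkLinearMap R⁰ M m) ≠ 0 := by
    by_contra! h
    exact hne ((Module.forall_dual_apply_eq_zero_iff (FractionRing R) _).1 h)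
  exact ⟨(f.restrictScalars R).comp (LocalizedModule.mkLinearMap R⁰ M), hf⟩

/-- An injective module receiving an injective linear map from a domain `R` has `ι 1` divisible
by every nonzero element of `R`. -/
theorem Module.Injective.exists_smul_eq_apply_one {R : Type*} [CommRing R] [IsDomain R]
    {I : Type*} [AddCommGroup I] [Module R I] (hI : Module.Injective R I)
    (ι : R →ₗ[R] I) (hι : Function.Injective ι) {r : R} (hr : r ≠ 0) :
    ∃ y : I, r • y = ι 1 := by
  have := small_of_injective hι
  obtain ⟨h, hh⟩ := Module.Injective.extension_property R I R R (LinearMap.mulLeft R r)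
    (mul_right_injective₀ hr) ι
  refine ⟨h 1, ?_⟩
  rw [← map_smul, ← hh]
  simp

/-- Over a commutative domain, the injective torsion submodule (the kernel of
`a ↦ a ⊗ ι 1 : A → A ⊗[R] I`, where `I` is injective and `ι : R → I` is an injective
linear map) coincides with the classical torsion: the elements annihilated by some
nonzero element of `R`. -/
theorem injectiveTorsion_eq_classicalTorsion
    {R : Type*} [CommRing R] [IsDomain R]
    {I : Type*} [AddCommGroup I] [Module R I]
    (hI : Module.Injective R I) (ι : R →ₗ[R] I) (hι : Function.Injective ι)
    (A : Type*) [AddCommGroup A] [Module R A] (a : A) :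
    a ∈ LinearMap.ker ((TensorProduct.mk R A I).flip (ι 1)) ↔
      ∃ r : R, r ≠ 0 ∧ r • a = 0 := by
  rw [LinearMap.mem_ker, LinearMap.flip_apply, TensorProduct.mk_apply]
  constructor
  · intro h
    by_contra! ha
    obtain ⟨φ, hφ⟩ := exists_linearMap_fractionRing_ne_zero a ha
    obtain ⟨ψ, hψ⟩ := exists_linearMap_fractionRing_ne_zero (ι 1) fun r hr h0 ↦
      hr (hι (by rwa [map_zero, ← mul_one r, ← smul_eq_mul, map_smul]))
    have hmul := congrArg (LinearMap.mul' R (FractionRing R) ∘ₗ TensorProduct.map φ ψ) h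
    rw [map_zero, LinearMap.comp_apply, TensorProduct.map_tmul, LinearMap.mul'_apply] at hmul
    exact mul_ne_zero hφ hψ hmul
  · rintro ⟨r, hr, hra⟩
    obtain ⟨y, hy⟩ := hI.exists_smul_eq_apply_one ι hι hr
    rw [← hy, ← TensorProduct.smul_tmul, hra, TensorProduct.zero_tmul]
end

section
/- Let R be a commutative ring, I an injective R-module, and ι : R → I an injective R-linear map. If A is a finitely presented R-module, then the injective torsion submodule s(A) equals the 1-torsion submodule t(A): an element a ∈ A satisfies a ⊗ ι(1) = 0 in A ⊗[R] I if and only if l(a) = 0 for every l ∈ Hom_R(A,R). -/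
open scoped TensorProduct

/-- A linear map to an injective module extends along any linear map whose kernel it kills. -/
theorem Module.Baer.exists_comp_eq_of_ker_le_ker {R : Type*} [CommRing R]
    {Q M N : Type*} [AddCommGroup Q] [Module R Q] [AddCommGroup M] [Module R M]
    [AddCommGroup N] [Module R N] (hQ : Module.Baer R Q) (p : M →ₗ[R] N) (f : M →ₗ[R] Q)
    (hpf : LinearMap.ker p ≤ LinearMap.ker f) : ∃ h : N →ₗ[R] Q, h ∘ₗ p = f := by
  obtain ⟨h, hh⟩ := hQ.extension_property ((LinearMap.ker p).liftQ p le_rfl)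
    (LinearMap.ker_eq_bot.mp (Submodule.ker_liftQ_eq_bot _ _ _ le_rfl))
    ((LinearMap.ker p).liftQ f hpf)
  exact ⟨h, LinearMap.ext fun x ↦ by simpa using LinearMap.congr_fun hh (Submodule.Quotient.mk x)⟩

/-- A linear map that kills the kernel of a surjective linear map descends along it. -/
theorem LinearMap.exists_comp_eq_of_surjective_of_ker_le_ker {R : Type*} [CommRing R]
    {M N P : Type*} [AddCommGroup M] [Module R M] [AddCommGroup N] [Module R N]
    [AddCommGroup P] [Module R P] (f : M →ₗ[R] N) (hf : Function.Surjective f) (l : M →ₗ[R] P)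
    (hfl : LinearMap.ker f ≤ LinearMap.ker l) : ∃ l' : N →ₗ[R] P, l' ∘ₗ f = l :=
  ⟨(LinearMap.ker f).liftQ l hfl ∘ₗ (f.quotKerEquivOfSurjective hf).symm.toLinearMap,
    LinearMap.ext fun x ↦ by
      have : (f.quotKerEquivOfSurjective hf).symm (f x) = Submodule.Quotient.mk x := by
        rw [LinearEquiv.symm_apply_eq]; rfl
      simp [this]⟩

/-- For a finitely presented module `A` over a commutative ring `R`, the injective torsion
submodule equals the 1-torsion submodule: `a ⊗ ι(1) = 0` in `A ⊗[R] I` (where `I` is an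
injective module and `ι : R → I` an injective linear map) if and only if `l a = 0` for
every linear functional `l : A → R`. -/
theorem injectiveTorsion_eq_oneTorsion_of_finitePresentation
    {R : Type*} [CommRing R]
    {I : Type*} [AddCommGroup I] [Module R I]
    (hI : Module.Injective R I) (ι : R →ₗ[R] I) (hι : Function.Injective ι)
    (A : Type*) [AddCommGroup A] [Module R A] [Module.FinitePresentation R A]
    (a : A) :
    (a ⊗ₜ[R] ι 1 : A ⊗[R] I) = 0 ↔ ∀ l : A →ₗ[R] R, l a = 0 := by
  constructor
  · intro h l
    have := congr(TensorProduct.lid R I (l.rTensor I $h))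
    rw [LinearMap.rTensor_tmul, TensorProduct.lid_tmul, ← map_smul, map_zero, map_zero] at this
    exact hι (by simpa using this)
  · intro ha
    have : Small.{u_2} R := small_of_injective hι
    obtain ⟨n, m, f, g, hf, hgf⟩ := Module.FinitePresentation.exists_fin' R A
    obtain ⟨c, rfl⟩ := hf a
    obtain ⟨h, hh⟩ := (Module.Baer.of_injective hI).exists_comp_eq_of_ker_le_ker
        g.dualMap (ι ∘ₗ Module.Dual.eval R (Fin n → R) c) fun l hl ↦ by
      obtain ⟨l', rfl⟩ := f.exists_comp_eq_of_surjective_of_ker_le_ker hf l fun x hx ↦ by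
        obtain ⟨y, rfl⟩ := (hgf x).mp hx
        exact LinearMap.congr_fun hl y
      simpa using congr(ι $(ha l'))
    have hc : f c ⊗ₜ[R] ι 1 = ∑ i, f (Pi.single i 1) ⊗ₜ[R] ι (c i) := by
      conv_lhs => rw [pi_eq_sum_univ' c]
      rw [map_sum, TensorProduct.sum_tmul]
      refine Finset.sum_congr rfl fun i _ ↦ ?_
      rw [map_smul, TensorProduct.smul_tmul, ← map_smul, smul_eq_mul, mul_one]
    rw [hc]
    refine TensorProduct.sum_tmul_eq_zero_of_vanishesTrivially R
      ⟨m, fun i j ↦ g (Pi.single j 1) i, fun j ↦ h (LinearMap.proj j), fun i ↦ ?_, fun j ↦ ?_⟩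
    · have hi : g.dualMap (LinearMap.proj i) =
          ∑ j, g (Pi.single j 1) i • (LinearMap.proj j : (Fin m → R) →ₗ[R] R) := by
        ext j
        simp [Pi.single_apply]
      have := LinearMap.congr_fun hh (LinearMap.proj i)
      rw [LinearMap.comp_apply, hi, map_sum] at this
      simpa using this.symm
    · rw [← hgf.apply_apply_eq_zero (Pi.single j 1)]
      conv_rhs => rw [pi_eq_sum_univ' (g _)]
      simp [map_sum]
end

section
/- Let R be a commutative ring, I an injective R-module, and ι : R → I an injective R-linear map. For any family (A_n)_{n ∈ N} of R-modules, an element a of the direct sum ⨁_{n} A_n lies in s(⨁_{n} A_n) if and only if for every n the component a(n) lies in s(A_n); in other words, the torsion functor commutes with direct sums. -/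
open scoped TensorProduct DirectSum

/-- The injective torsion functor commutes with direct sums: an element `a` of a direct sum
`⨁ n, A n` lies in `s(⨁ n, A n)` (i.e. `a ⊗ ι(1) = 0`) if and only if each component
`a n` lies in `s(A n)`. -/
theorem injectiveTorsion_directSum
    {R : Type*} [CommRing R]
    {I : Type*} [AddCommGroup I] [Module R I]
    (hI : Module.Injective R I) (ι : R →ₗ[R] I) (hι : Function.Injective ι)
    {N : Type*} [DecidableEq N]
    (A : N → Type*) [∀ n, AddCommGroup (A n)] [∀ n, Module R (A n)]
    (a : ⨁ n, A n) :
    a ∈ LinearMap.ker ((TensorProduct.mk R (⨁ n, A n) I).flip (ι 1)) ↔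
      ∀ n, a n ∈ LinearMap.ker ((TensorProduct.mk R (A n) I).flip (ι 1)) := by
  simp only [LinearMap.mem_ker, LinearMap.flip_apply, TensorProduct.mk_apply]
  rw [← (TensorProduct.directSumLeft R R A I).map_eq_zero_iff, DFinsupp.ext_iff]
  exact forall_congr' fun n => by
    rw [← TensorProduct.directSumLeft_tmul R R a (ι 1) n]
    rfl
end

section
/- Let R be a commutative ring, I an injective R-module, and ι : R → I an injective R-linear map. The torsion functor s is a radical: for every R-module A, the injective torsion submodule of the quotient module A ⧸ s(A) is zero, i.e., if x ∈ A ⧸ s(A) satisfies x ⊗ ι(1) = 0 in (A ⧸ s(A)) ⊗[R] I, then x = 0. -/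
open scoped TensorProduct

/-- If `φ p ⊗ ι 1` vanishes, then finitely many elements of `ker φ` suffice to force every linear
form vanishing on them to vanish at `p`. -/
theorem exists_finset_ker_of_tmul_eq_zero
    {R I F M : Type*} [CommRing R] [AddCommGroup I] [Module R I]
    [AddCommGroup F] [Module R F] [AddCommGroup M] [Module R M]
    {ι : R →ₗ[R] I} (hι : Function.Injective ι) {φ : F →ₗ[R] M} (hφ : Function.Surjective φ)
    {p : F} (hp : φ p ⊗ₜ[R] ι 1 = 0) :
    ∃ S : Finset F, (∀ s ∈ S, φ s = 0) ∧
      ∀ f : F →ₗ[R] R, (∀ s ∈ S, f s = 0) → f p = 0 := by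
  classical
  obtain ⟨t, ht⟩ := (rTensor_exact I (LinearMap.exact_subtype_ker_map φ) hφ (p ⊗ₜ[R] ι 1)).1
    (by simpa using hp)
  obtain ⟨T, rfl⟩ := TensorProduct.exists_finset t
  refine ⟨T.image fun k ↦ (k.1 : F), ?_, fun f hf ↦ hι ?_⟩
  · simp only [Finset.mem_image]
    rintro _ ⟨k, -, rfl⟩
    exact k.1.2
  · have h := congrArg ((TensorProduct.lid R I).toLinearMap ∘ₗ f.rTensor I) ht
    simp only [map_sum, LinearMap.comp_apply, LinearMap.rTensor_tmul, LinearEquiv.coe_coe,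
      TensorProduct.lid_tmul, Submodule.subtype_apply] at h
    rw [Finset.sum_eq_zero fun k hk ↦ by
      rw [hf _ (Finset.mem_image_of_mem _ hk), zero_smul], ← map_smul, smul_eq_mul, mul_one] at h
    rw [← h, map_zero]

/-- A converse for free sources: if every linear form vanishing on a finite subset of `ker φ`
vanishes at `p`, then `φ p ⊗ ι 1` vanishes. -/
theorem tmul_eq_zero_of_finset_ker
    {R I σ M : Type*} [CommRing R] [AddCommGroup I] [Module R I]
    [AddCommGroup M] [Module R M] (hI : Module.Baer R I) (ι : R →ₗ[R] I)
    {φ : (σ →₀ R) →ₗ[R] M} {p : σ →₀ R} {S : Finset (σ →₀ R)} (hS : ∀ s ∈ S, φ s = 0)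
    (hp : ∀ f : (σ →₀ R) →ₗ[R] R, (∀ s ∈ S, f s = 0) → f p = 0) :
    φ p ⊗ₜ[R] ι 1 = 0 := by
  classical
  let ρ : ((σ →₀ R) →ₗ[R] R) →ₗ[R] (S → R) := LinearMap.pi fun s ↦ LinearMap.applyₗ (s : σ →₀ R)
  have hρ : LinearMap.ker ρ ≤ LinearMap.ker (ι ∘ₗ LinearMap.applyₗ p) := fun f hf ↦ by
    have : f p = 0 := hp f fun s hs ↦ congrFun (LinearMap.mem_ker.1 hf) ⟨s, hs⟩
    simp [this]
  obtain ⟨g, hg⟩ := hI.extension_property ((LinearMap.ker ρ).liftQ ρ le_rfl)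
    (LinearMap.ker_eq_bot.1 (Submodule.ker_liftQ_eq_bot _ _ _ le_rfl))
    ((LinearMap.ker ρ).liftQ _ hρ)
  have key : p ⊗ₜ[R] ι 1 = ∑ s : S, (s : σ →₀ R) ⊗ₜ[R] g (Pi.single s 1) := by
    apply (TensorProduct.finsuppScalarLeft R I σ).injective
    ext i
    have h : g (ρ (Finsupp.lapply i)) = ι (p i) := by
      simpa using LinearMap.congr_fun hg ((LinearMap.ker ρ).mkQ (Finsupp.lapply i))
    rw [pi_eq_sum_univ' (ρ (Finsupp.lapply i))] at h
    simp only [map_sum, Finsupp.finsetSum_apply,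
      TensorProduct.finsuppScalarLeft_apply_tmul_apply]
    rw [← map_smul, smul_eq_mul, mul_one, ← h, map_sum]
    refine Finset.sum_congr rfl fun s _ ↦ ?_
    rw [map_smul]
    congr 2
  have h := congrArg (φ.rTensor I) key
  rw [LinearMap.rTensor_tmul, map_sum] at h
  rw [h]
  exact Finset.sum_eq_zero fun s _ ↦ by
    rw [LinearMap.rTensor_tmul, hS _ s.2, TensorProduct.zero_tmul]

/-- The injective torsion functor is a radical: for every module `A`, the injective torsion
submodule of `A ⧸ s(A)` is zero, i.e. if `x ∈ A ⧸ s(A)` satisfies `x ⊗ ι(1) = 0`, then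
`x = 0`. -/
theorem injectiveTorsion_radical
    {R : Type*} [CommRing R]
    {I : Type*} [AddCommGroup I] [Module R I]
    (hI : Module.Injective R I) (ι : R →ₗ[R] I) (hι : Function.Injective ι)
    (A : Type*) [AddCommGroup A] [Module R A]
    (x : A ⧸ LinearMap.ker ((TensorProduct.mk R A I).flip (ι 1)))
    (hx : x ⊗ₜ[R] ι 1 = 0) :
    x = 0 := by
  classical
  have : Small R := small_of_injective hι
  have hB : Module.Baer R I := .of_injective hI
  let φ : (A →₀ R) →ₗ[R] A := Finsupp.linearCombination R id
  have hφ : Function.Surjective φ := Finsupp.linearCombination_id_surjective R A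
  obtain ⟨a, rfl⟩ := Submodule.mkQ_surjective _ x
  obtain ⟨p, rfl⟩ := hφ a
  obtain ⟨S, hS, hSp⟩ := exists_finset_ker_of_tmul_eq_zero hι
    (φ := Submodule.mkQ _ ∘ₗ φ) ((Submodule.mkQ_surjective _).comp hφ) hx
  have hT (s : S) := exists_finset_ker_of_tmul_eq_zero hι hφ (p := s)
    ((Submodule.Quotient.mk_eq_zero _).1 (hS s s.2))
  choose T hTker hT using hT
  refine (Submodule.Quotient.mk_eq_zero _).2 (LinearMap.mem_ker.2 ?_)
  refine tmul_eq_zero_of_finset_ker hB ι (S := Finset.univ.biUnion T) ?_ fun f hf ↦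
    hSp f fun s hs ↦ hT ⟨s, hs⟩ f fun t ht ↦ hf t ?_
  · simp only [Finset.mem_biUnion]
    rintro t ⟨s, -, ht⟩
    exact hTker s t ht
  · exact Finset.mem_biUnion.2 ⟨_, Finset.mem_univ _, ht⟩
end

section
/- Let R be a commutative ring, I an injective R-module, and ι : R → I an injective R-linear map. The following are equivalent: (a) the torsion functor s preserves epimorphisms, i.e., for every surjective R-linear map f : A → B, f maps s(A) onto s(B); (b) s is the zero functor, i.e., s(A) = 0 for every R-module A. -/
open scoped TensorProduct

universe u

/-- The injective torsion submodule of a flat module vanishes. -/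
theorem ker_mk_flip_eq_bot_of_flat {R A I : Type*} [CommRing R]
    [AddCommGroup A] [Module R A] [Module.Flat R A] [AddCommGroup I] [Module R I]
    (ι : R →ₗ[R] I) (hι : Function.Injective ι) :
    LinearMap.ker ((TensorProduct.mk R A I).flip (ι 1)) = ⊥ := by
  have h : (TensorProduct.mk R A I).flip (ι 1) =
      ι.lTensor A ∘ₗ (TensorProduct.rid R A).symm.toLinearMap := by
    ext a
    simp
  rw [h, LinearMap.ker_eq_bot]
  exact (Module.Flat.lTensor_preserves_injective_linearMap ι hι).comp
    (TensorProduct.rid R A).symm.injective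

/-- The injective torsion functor `s` preserves epimorphisms (i.e. every surjective linear
map `f : A → B` maps `s(A)` onto `s(B)`) if and only if `s` is the zero functor
(`s(A) = 0` for every module `A`). -/
theorem injectiveTorsion_preserves_epi_iff_zero
    {R : Type u} [CommRing R]
    {I : Type u} [AddCommGroup I] [Module R I]
    (hI : Module.Injective R I) (ι : R →ₗ[R] I) (hι : Function.Injective ι) :
    (∀ (A B : Type u) [AddCommGroup A] [Module R A] [AddCommGroup B] [Module R B]
        (f : A →ₗ[R] B), Function.Surjective f →
        Submodule.map f (LinearMap.ker ((TensorProduct.mk R A I).flip (ι 1))) =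
          LinearMap.ker ((TensorProduct.mk R B I).flip (ι 1))) ↔
      (∀ (A : Type u) [AddCommGroup A] [Module R A],
        LinearMap.ker ((TensorProduct.mk R A I).flip (ι 1)) = ⊥) := by
  constructor
  · intro h A _ _
    rw [← h (A →₀ R) A (Finsupp.linearCombination R id)
        (Finsupp.linearCombination_id_surjective R A),
      ker_mk_flip_eq_bot_of_flat ι hι, Submodule.map_bot]
  · intro h A B _ _ _ _ f _
    rw [h A, h B, Submodule.map_bot]
end

section
/- Let R be a commutative ring, I an injective R-module, and ι : R → I an injective R-linear map, and assume moreover that I is a flat R-module. Then for every R-module A the submodule s(A), regarded as an R-module in its own right, is a torsion module: the R-linear map s(A) → s(A) ⊗[R] I sending x to x ⊗ ι(1) is the zero map. In particular s(s(A)) = s(A), i.e., s is idempotent. -/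
open scoped TensorProduct

/-- If `I` is flat, the kernel of `a ↦ a ⊗ₜ i` on `A` is killed by `· ⊗ₜ i` as a module in its
own right, since tensoring its inclusion into `A` with `I` stays injective. -/
theorem tmul_eq_zero_of_mem_ker_of_flat {R I A : Type*} [CommRing R]
    [AddCommGroup I] [Module R I] [Module.Flat R I] [AddCommGroup A] [Module R A] (i : I)
    (x : LinearMap.ker ((TensorProduct.mk R A I).flip i)) :
    (x ⊗ₜ[R] i : (LinearMap.ker ((TensorProduct.mk R A I).flip i)) ⊗[R] I) = 0 := by
  apply Module.Flat.rTensor_preserves_injective_linearMap (M := I) _ (Submodule.injective_subtype _)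
  rw [map_zero, LinearMap.rTensor_tmul]
  exact x.2

/-- If the injective module `I` (receiving an injective linear map `ι : R → I`) is moreover
flat, then for every module `A` the submodule `s(A)`, regarded as a module in its own right,
is a torsion module: the map `s(A) → s(A) ⊗[R] I`, `x ↦ x ⊗ ι 1`, is zero.  In particular
`s(s(A)) = s(A)`, i.e. the torsion functor is idempotent. -/
theorem injectiveTorsion_idempotent_of_flat
    {R : Type*} [CommRing R]
    {I : Type*} [AddCommGroup I] [Module R I] [Module.Flat R I]
    (hI : Module.Injective R I) (ι : R →ₗ[R] I) (hι : Function.Injective ι)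
    (A : Type*) [AddCommGroup A] [Module R A] :
    (∀ x : LinearMap.ker ((TensorProduct.mk R A I).flip (ι 1)),
        (x ⊗ₜ[R] ι 1 :
          (LinearMap.ker ((TensorProduct.mk R A I).flip (ι 1))) ⊗[R] I) = 0) ∧
      LinearMap.ker ((TensorProduct.mk R
          (LinearMap.ker ((TensorProduct.mk R A I).flip (ι 1))) I).flip (ι 1)) = ⊤ := by
  refine ⟨tmul_eq_zero_of_mem_ker_of_flat (ι 1), ?_⟩
  rw [eq_top_iff]
  exact fun x _ => tmul_eq_zero_of_mem_ker_of_flat (ι 1) x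
end

section
/- Let R be a commutative ring, I an injective R-module, and ι : R → I an injective R-linear map, and assume moreover that I is a flat R-module. Then the class of torsion-free modules is closed under extensions: if 0 → A' → A → A'' → 0 is a short exact sequence of R-modules (i.e., f : A' → A is injective, g : A → A'' is surjective, and the range of f equals the kernel of g) with s(A') = 0 and s(A'') = 0, then s(A) = 0. -/
open scoped TensorProduct

/-- If the injective module `I` (receiving an injective linear map `ι : R → I`) is moreover
flat, then the class of torsion-free modules is closed under extensions: given a short exact
sequence `0 → A' → A → A'' → 0`, if `s(A') = 0` and `s(A'') = 0` then `s(A) = 0`. -/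
theorem torsionFree_closed_under_extensions_of_flat
    {R : Type*} [CommRing R]
    {I : Type*} [AddCommGroup I] [Module R I] [Module.Flat R I]
    (hI : Module.Injective R I) (ι : R →ₗ[R] I) (hι : Function.Injective ι)
    {A' A A'' : Type*} [AddCommGroup A'] [Module R A'] [AddCommGroup A] [Module R A]
    [AddCommGroup A''] [Module R A'']
    (f : A' →ₗ[R] A) (g : A →ₗ[R] A'')
    (hf : Function.Injective f) (hg : Function.Surjective g)
    (hfg : LinearMap.range f = LinearMap.ker g)
    (hA' : LinearMap.ker ((TensorProduct.mk R A' I).flip (ι 1)) = ⊥)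
    (hA'' : LinearMap.ker ((TensorProduct.mk R A'' I).flip (ι 1)) = ⊥) :
    LinearMap.ker ((TensorProduct.mk R A I).flip (ι 1)) = ⊥ := by
  rw [LinearMap.ker_eq_bot'] at hA' hA'' ⊢
  simp only [LinearMap.flip_apply, TensorProduct.mk_apply] at hA' hA'' ⊢
  intro a ha
  have hga : g a = 0 := hA'' _ (by simpa using congrArg (g.rTensor I) ha)
  obtain ⟨b, rfl⟩ : a ∈ LinearMap.range f := hfg ▸ hga
  have hb : b ⊗ₜ[R] ι 1 = 0 :=
    Module.Flat.rTensor_preserves_injective_linearMap f hf (by simpa using ha)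
  rw [hA' b hb, map_zero]
end

section
/- Let R be a commutative ring, I an injective R-module, and ι : R → I an injective R-linear map. For every R-module A, every flat R-module F, and every R-linear map f : A → F, the injective torsion submodule s(A) is contained in the kernel of f. In other words, s(A) is contained in the reject of the class of flat modules in A. -/
open scoped TensorProduct

/-- For every module `A`, every flat module `F`, and every linear map `f : A → F`, the
injective torsion submodule `s(A)` is contained in the kernel of `f`; i.e. `s(A)` is
contained in the reject of the class of flat modules in `A`. -/
theorem injectiveTorsion_le_ker_toFlat
    {R : Type*} [CommRing R]
    {I : Type*} [AddCommGroup I] [Module R I]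
    (hI : Module.Injective R I) (ι : R →ₗ[R] I) (hι : Function.Injective ι)
    (A : Type*) [AddCommGroup A] [Module R A]
    (F : Type*) [AddCommGroup F] [Module R F] [Module.Flat R F]
    (f : A →ₗ[R] F) :
    LinearMap.ker ((TensorProduct.mk R A I).flip (ι 1)) ≤ LinearMap.ker f := by
  intro a ha
  have ha' : a ⊗ₜ[R] ι 1 = 0 := ha
  have hfa : f a ⊗ₜ[R] ι 1 = 0 := by
    simpa only [LinearMap.rTensor_tmul, map_zero] using congrArg (f.rTensor I) ha'
  have hflat := Module.Flat.lTensor_preserves_injective_linearMap (M := F) ι hι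
  have hone : f a ⊗ₜ[R] (1 : R) = 0 := hflat (by rwa [LinearMap.lTensor_tmul, map_zero])
  simpa using congrArg (TensorProduct.rid R F) hone
end

section
/- Let R be a ring which is left noetherian and left hereditary (every left ideal of R is projective as a left R-module). Then for every left R-module C, the canonical surjection C → q(C) splits; equivalently, the trace Tr(I,C) of the injectives in C is a direct summand of C, i.e., there exists a submodule D of C with C = Tr(I,C) ⊕ D. -/
universe u

/-- The trace of the class of injective left `R`-modules in a left `R`-module `C`:
the supremum of the ranges of all linear maps from injective modules to `C`. -/
def injectiveTrace (R : Type u) [Ring R] (C : Type u) [AddCommGroup C] [Module R C] :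
    Submodule R C :=
  sSup {p : Submodule R C | ∃ (J : Type u) (_ : AddCommGroup J) (_ : Module R J),
    Module.Injective R J ∧ ∃ h : J →ₗ[R] C, p = LinearMap.range h}

/-- A product of two modules satisfying Baer's criterion satisfies Baer's criterion. -/
theorem Module.Baer.prod {R M N : Type*} [Ring R] [AddCommGroup M] [Module R M]
    [AddCommGroup N] [Module R N] (hM : Module.Baer R M) (hN : Module.Baer R N) :
    Module.Baer R (M × N) := by
  intro I g
  obtain ⟨a, ha⟩ := hM I (LinearMap.fst R M N ∘ₗ g)
  obtain ⟨b, hb⟩ := hN I (LinearMap.snd R M N ∘ₗ g)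
  exact ⟨a.prod b, fun x hx ↦ Prod.ext (ha x hx) (hb x hx)⟩

/-- Every finitely generated submodule of the trace of the injectives is contained in the range
of a linear map from a single injective module. -/
theorem exists_le_range_of_fg_of_le_injectiveTrace {R : Type u} [Ring R] {C : Type u}
    [AddCommGroup C] [Module R C] {N : Submodule R C} (hN : N.FG)
    (hle : N ≤ injectiveTrace R C) :
    ∃ (J : Type u) (_ : AddCommGroup J) (_ : Module R J),
      Module.Injective R J ∧ ∃ h : J →ₗ[R] C, N ≤ LinearMap.range h := by
  have hcompact := (Submodule.fg_iff_compact N).1 hN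
  rw [CompleteLattice.isCompactElement_iff_le_of_directed_sSup_le] at hcompact
  rw [injectiveTrace] at hle
  refine (hcompact _ ?_ ?_ hle).elim ?_
  · exact ⟨⊥, PUnit, inferInstance, inferInstance,
      Module.Baer.injective fun _ _ ↦ ⟨0, fun _ _ ↦ Subsingleton.elim _ _⟩, 0, by simp⟩
  · rintro _ ⟨J, _, _, hJ, h, rfl⟩ _ ⟨J', _, _, hJ', h', rfl⟩
    exact ⟨_, ⟨J × J', inferInstance, inferInstance,
      ((Module.Baer.of_injective hJ).prod (Module.Baer.of_injective hJ')).injective,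
      h.coprod h', (LinearMap.range_coprod h h').symm⟩, le_sup_left, le_sup_right⟩
  · rintro _ ⟨⟨J, _, _, hJ, h, rfl⟩, hNh⟩
    exact ⟨J, _, _, hJ, h, hNh⟩

/-- Over a left noetherian left hereditary ring the trace of the injectives satisfies Baer's
criterion. -/
theorem baer_injectiveTrace {R : Type u} [Ring R] [IsNoetherianRing R]
    (hered : ∀ J : Ideal R, Module.Projective R J)
    (C : Type u) [AddCommGroup C] [Module R C] :
    Module.Baer R (injectiveTrace R C) := by
  intro I g
  have := hered I
  let f : I →ₗ[R] C := (injectiveTrace R C).subtype ∘ₗ g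
  have hf : LinearMap.range f ≤ injectiveTrace R C := by
    rintro _ ⟨x, rfl⟩
    exact (g x).2
  obtain ⟨J, _, _, hJ, h, hfh⟩ := exists_le_range_of_fg_of_le_injectiveTrace
    (IsNoetherian.noetherian (⊤ : Submodule R I) |>.map f) (by rwa [Submodule.map_top])
  rw [Submodule.map_top] at hfh
  have hle : LinearMap.range h ≤ injectiveTrace R C := le_sSup ⟨J, _, _, hJ, h, rfl⟩
  obtain ⟨l, hl⟩ := Module.projective_lifting_property h.rangeRestrict
    (f.codRestrict (LinearMap.range h) fun x ↦ hfh ⟨x, rfl⟩) h.surjective_rangeRestrict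
  obtain ⟨e, he⟩ := Module.Baer.of_injective hJ I l
  refine ⟨h.codRestrict _ (fun y ↦ hle ⟨y, rfl⟩) ∘ₗ e, fun x hx ↦ Subtype.ext ?_⟩
  simpa [he x hx, f] using congrArg Subtype.val (LinearMap.congr_fun hl ⟨x, hx⟩)

/-- If `R` is left noetherian and left hereditary (every left ideal is projective), then for
every left `R`-module `C` the canonical surjection `C → q(C)` splits; equivalently, the
trace of the injectives in `C` is a direct summand of `C`. -/
theorem injectiveTrace_isCompl_of_noetherian_hereditary
    {R : Type u} [Ring R] [IsNoetherianRing R]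
    (hered : ∀ J : Ideal R, Module.Projective R J)
    (C : Type u) [AddCommGroup C] [Module R C] :
    ∃ D : Submodule R C, IsCompl (injectiveTrace R C) D := by
  obtain ⟨r, hr⟩ := (baer_injectiveTrace hered C).extension_property
    (injectiveTrace R C).subtype (Submodule.subtype_injective _) LinearMap.id
  exact ⟨LinearMap.ker r, LinearMap.isCompl_of_proj fun x ↦ LinearMap.congr_fun hr x⟩
end

section
/- Let R be a ring. The following are equivalent: (a) the cotorsion functor q preserves monomorphisms, i.e., for every injective R-linear map f : C' → C of left R-modules and every x ∈ C', if f(x) ∈ Tr(I,C) then x ∈ Tr(I,C'); (b) q is the zero functor, i.e., Tr(I,C) = C for every left R-module C; (c) R is injective as a left module over itself. -/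
universe u

/-- The product of two injective modules is injective. -/
lemma Module.Injective.prod {R : Type u} [Ring R] {M N : Type u} [AddCommGroup M] [Module R M]
    [AddCommGroup N] [Module R N] (hM : Module.Injective R M) (hN : Module.Injective R N) :
    Module.Injective R (M × N) where
  out X Y _ _ _ _ f hf g := by
    obtain ⟨a, ha⟩ := hM.out f hf (LinearMap.fst R M N ∘ₗ g)
    obtain ⟨b, hb⟩ := hN.out f hf (LinearMap.snd R M N ∘ₗ g)
    exact ⟨a.prod b, fun x => Prod.ext (ha x) (hb x)⟩

/-- A retract of an injective module is injective. -/
lemma Module.Injective.of_retract {R : Type u} [Ring R] {M N : Type u} [AddCommGroup M]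
    [Module R M] [AddCommGroup N] [Module R N] (hM : Module.Injective R M)
    (i : N →ₗ[R] M) (p : M →ₗ[R] N) (hpi : ∀ x, p (i x) = x) : Module.Injective R N where
  out X Y _ _ _ _ f hf g := by
    obtain ⟨a, ha⟩ := hM.out f hf (i ∘ₗ g)
    refine ⟨p ∘ₗ a, fun x => ?_⟩
    rw [LinearMap.comp_apply, ha, LinearMap.comp_apply, hpi]

/-- Every module embeds in an injective module. -/
lemma Module.exists_injective_embedding (R : Type u) [Ring R] (C : Type u) [AddCommGroup C]
    [Module R C] : ∃ (J : Type u) (_ : AddCommGroup J) (_ : Module R J),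
      Module.Injective R J ∧ ∃ f : C →ₗ[R] J, Function.Injective f := by
  let E := CategoryTheory.Injective.under (ModuleCat.of R C)
  exact ⟨E, inferInstance, inferInstance, (Module.injective_iff_injective_object R E).mpr
    (inferInstanceAs (CategoryTheory.Injective E)),
    (CategoryTheory.Injective.ι (ModuleCat.of R C)).hom,
    (ModuleCat.mono_iff_injective _).mp inferInstance⟩

/-- An element lies in the trace of injectives iff it is in the range of a single linear map
from an injective module. -/
lemma mem_injectiveTrace_iff {R : Type u} [Ring R] {C : Type u} [AddCommGroup C] [Module R C]
    {x : C} : x ∈ injectiveTrace R C ↔ ∃ (J : Type u) (_ : AddCommGroup J) (_ : Module R J),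
      Module.Injective R J ∧ ∃ h : J →ₗ[R] C, x ∈ LinearMap.range h := by
  rw [injectiveTrace, Submodule.mem_sSup_of_directed]
  · constructor
    · rintro ⟨_, ⟨J, _, _, hJ, h, rfl⟩, hx⟩
      exact ⟨J, _, _, hJ, h, hx⟩
    · rintro ⟨J, _, _, hJ, h, hx⟩
      exact ⟨_, ⟨J, _, _, hJ, h, rfl⟩, hx⟩
  · exact ⟨_, PUnit, inferInstance, inferInstance, ⟨fun _ _ _ _ _ _ _ _ _ => ⟨0, fun _ => rfl⟩⟩,
      0, rfl⟩
  · rintro _ ⟨J, _, _, hJ, g, rfl⟩ _ ⟨K, _, _, hK, h, rfl⟩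
    refine ⟨_, ⟨J × K, _, _, hJ.prod hK, g.coprod h, rfl⟩, ?_, ?_⟩ <;>
      rw [LinearMap.range_coprod]
    exacts [le_sup_left, le_sup_right]

/-- The trace of injectives in an injective module is the whole module. -/
lemma injectiveTrace_eq_top {R : Type u} [Ring R] {J : Type u} [AddCommGroup J] [Module R J]
    (hJ : Module.Injective R J) : injectiveTrace R J = ⊤ :=
  eq_top_iff.mpr fun x _ => mem_injectiveTrace_iff.mpr ⟨J, _, _, hJ, LinearMap.id, x, rfl⟩

/-- The following are equivalent: (a) the cotorsion functor `q` preserves monomorphisms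
(for every injective linear map `f : C' → C` and `x ∈ C'`, if `f x ∈ Tr(𝓘,C)` then
`x ∈ Tr(𝓘,C')`); (b) `q` is the zero functor (`Tr(𝓘,C) = C` for every `C`);
(c) `R` is injective as a left module over itself. -/
theorem cotorsion_preserves_mono_iff_zero_iff_selfinjective {R : Type u} [Ring R] :
    ((∀ (C' C : Type u) [AddCommGroup C'] [Module R C'] [AddCommGroup C] [Module R C]
        (f : C' →ₗ[R] C), Function.Injective f →
          ∀ x : C', f x ∈ injectiveTrace R C → x ∈ injectiveTrace R C') ↔
      (∀ (C : Type u) [AddCommGroup C] [Module R C], injectiveTrace R C = ⊤)) ∧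
    ((∀ (C : Type u) [AddCommGroup C] [Module R C], injectiveTrace R C = ⊤) ↔
      Module.Injective R R) := by
  refine ⟨⟨fun H C _ _ => ?_, fun H C' C _ _ _ _ f _ x _ => H C' ▸ Submodule.mem_top⟩,
    fun H => ?_, fun H C _ _ => ?_⟩
  · obtain ⟨J, _, _, hJ, f, hf⟩ := Module.exists_injective_embedding R C
    exact eq_top_iff.mpr fun x _ => H C J f hf x (injectiveTrace_eq_top hJ ▸ Submodule.mem_top)
  · have h1 : (1 : R) ∈ injectiveTrace R R := H R ▸ Submodule.mem_top
    obtain ⟨J, _, _, hJ, h, j, hj⟩ := mem_injectiveTrace_iff.mp h1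
    exact hJ.of_retract (LinearMap.toSpanSingleton R J j) h fun x => by simp [hj]
  · exact eq_top_iff.mpr fun x _ => mem_injectiveTrace_iff.mpr
      ⟨R, _, _, H, LinearMap.toSpanSingleton R C x, 1, by simp⟩
end

section
/- Let R be a ring and suppose there exists a left R-module I₀ which is both injective and projective together with an injective R-linear map R → I₀ (i.e., the injective envelope of R is projective). Then for every left R-module C, the trace of the injectives in the cotorsion quotient is zero: Tr(I, C ⧸ Tr(I,C)) = 0. Consequently the natural map q(C) → q(q(C)) is an isomorphism. -/
universe u

theorem range_le_injectiveTrace {R : Type u} [Ring R] {J C : Type u} [AddCommGroup J]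
    [Module R J] [AddCommGroup C] [Module R C] [hJ : Module.Injective R J] (f : J →ₗ[R] C) :
    LinearMap.range f ≤ injectiveTrace R C :=
  le_sSup ⟨J, _, _, hJ, f, rfl⟩

/-- A map from an injective projective module to `C ⧸ injectiveTrace R C` lifts to `C`, hence
vanishes. -/
theorem linearMap_quotient_injectiveTrace_eq_zero {R : Type u} [Ring R] {P C : Type u}
    [AddCommGroup P] [Module R P] [AddCommGroup C] [Module R C] [Module.Injective R P]
    [Module.Projective R P] (f : P →ₗ[R] C ⧸ injectiveTrace R C) : f = 0 := by
  obtain ⟨l, rfl⟩ := Module.projective_lifting_property (injectiveTrace R C).mkQ f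
    (Submodule.mkQ_surjective _)
  ext x
  simpa using range_le_injectiveTrace l ⟨x, rfl⟩

/-- Suppose there is a left `R`-module `I₀` which is both injective and projective, together
with an injective linear map `R → I₀` (the injective envelope of `R` is projective).  Then
for every left `R`-module `C` the trace of the injectives in the cotorsion quotient
`C ⧸ Tr(𝓘,C)` is zero; consequently the natural map `q(C) → q(q(C))` is an isomorphism. -/
theorem injectiveTrace_of_quotient_eq_bot
    {R : Type u} [Ring R]
    (h : ∃ (I₀ : Type u) (_ : AddCommGroup I₀) (_ : Module R I₀),
      Module.Injective R I₀ ∧ Module.Projective R I₀ ∧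
        ∃ j : R →ₗ[R] I₀, Function.Injective j)
    (C : Type u) [AddCommGroup C] [Module R C] :
    injectiveTrace R (C ⧸ injectiveTrace R C) = ⊥ ∧
      Function.Bijective (injectiveTrace R (C ⧸ injectiveTrace R C)).mkQ := by
  have hbot : injectiveTrace R (C ⧸ injectiveTrace R C) = ⊥ := by
    obtain ⟨I₀, _, _, _, _, j, hj⟩ := h
    rw [eq_bot_iff]
    refine sSup_le ?_
    rintro _ ⟨J, _, _, hJ, f, rfl⟩ _ ⟨x, rfl⟩
    obtain ⟨g, hg⟩ := hJ.out j hj (LinearMap.toSpanSingleton R J x)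
    have hx : g (j 1) = x := by simp [hg]
    have hfg := LinearMap.congr_fun (linearMap_quotient_injectiveTrace_eq_zero (f ∘ₗ g)) (j 1)
    simpa [hx] using hfg
  refine ⟨hbot, ?_, Submodule.mkQ_surjective _⟩
  rw [← LinearMap.ker_eq_bot, Submodule.ker_mkQ, hbot]
end

section
/- Let R be a ring and suppose there exists a left R-module I₀ which is both injective and projective together with an injective R-linear map R → I₀ (i.e., the injective envelope of R is projective). Then the class of cotorsion-free modules is closed under extensions: if 0 → C' → C → C'' → 0 is a short exact sequence of left R-modules (i.e., f : C' → C is injective, g : C → C'' is surjective, and the range of f equals the kernel of g) with Tr(I,C') = C' and Tr(I,C'') = C'', then Tr(I,C) = C. -/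
universe u

/-- If `R` embeds in a module `I₀` via `j`, then every element of the trace of the
injective modules in `C` is the image of `j 1` under a single linear map `I₀ → C`. -/
theorem exists_apply_one_eq_of_mem_injectiveTrace {R : Type u} [Ring R]
    {I₀ : Type u} [AddCommGroup I₀] [Module R I₀] (j : R →ₗ[R] I₀) (hj : Function.Injective j)
    {C : Type u} [AddCommGroup C] [Module R C] {x : C} (hx : x ∈ injectiveTrace R C) :
    ∃ k : I₀ →ₗ[R] C, k (j 1) = x := by
  rw [injectiveTrace, sSup_eq_iSup'] at hx
  induction hx using Submodule.iSup_induction' with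
  | mem p x hx =>
    obtain ⟨_, J, _, _, hJ, φ, rfl⟩ := p
    obtain ⟨y, rfl⟩ := hx
    obtain ⟨k, hk⟩ := hJ.out j hj (LinearMap.toSpanSingleton R J y)
    exact ⟨φ ∘ₗ k, by simp [hk]⟩
  | zero => exact ⟨0, rfl⟩
  | add x y _ _ hx hy =>
    obtain ⟨k, rfl⟩ := hx
    obtain ⟨l, rfl⟩ := hy
    exact ⟨k + l, rfl⟩

/-- The range of a linear map from an injective module lies in the trace. -/
theorem apply_mem_injectiveTrace {R : Type u} [Ring R]
    {J : Type u} [AddCommGroup J] [Module R J] (hJ : Module.Injective R J)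
    {C : Type u} [AddCommGroup C] [Module R C] (k : J →ₗ[R] C) (y : J) :
    k y ∈ injectiveTrace R C :=
  (le_sSup ⟨J, inferInstance, inferInstance, hJ, k, rfl⟩ :
    LinearMap.range k ≤ injectiveTrace R C) ⟨y, rfl⟩

/-- Suppose there is a left `R`-module `I₀` which is both injective and projective, together
with an injective linear map `R → I₀` (the injective envelope of `R` is projective).  Then
the class of cotorsion-free modules (those with `Tr(𝓘,C) = C`) is closed under extensions:
given a short exact sequence `0 → C' → C → C'' → 0` with `C'` and `C''` cotorsion-free,
`C` is cotorsion-free. -/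
theorem cotorsionFree_closed_under_extensions
    {R : Type u} [Ring R]
    (h : ∃ (I₀ : Type u) (_ : AddCommGroup I₀) (_ : Module R I₀),
      Module.Injective R I₀ ∧ Module.Projective R I₀ ∧
        ∃ j : R →ₗ[R] I₀, Function.Injective j)
    {C' C C'' : Type u} [AddCommGroup C'] [Module R C'] [AddCommGroup C] [Module R C]
    [AddCommGroup C''] [Module R C'']
    (f : C' →ₗ[R] C) (g : C →ₗ[R] C'')
    (hf : Function.Injective f) (hg : Function.Surjective g)
    (hfg : LinearMap.range f = LinearMap.ker g)
    (hC' : injectiveTrace R C' = ⊤) (hC'' : injectiveTrace R C'' = ⊤) :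
    injectiveTrace R C = ⊤ := by
  obtain ⟨I₀, _, _, hinj, _, j, hj⟩ := h
  refine eq_top_iff.mpr fun x _ => ?_
  obtain ⟨k, hk⟩ := exists_apply_one_eq_of_mem_injectiveTrace j hj
    (hC'' ▸ Submodule.mem_top : g x ∈ _)
  obtain ⟨l, hl⟩ := Module.projective_lifting_property g k hg
  have hmem : x - l (j 1) ∈ LinearMap.range f := by
    rw [hfg, LinearMap.mem_ker, map_sub, ← hk, ← hl, LinearMap.comp_apply, sub_self]
  obtain ⟨c, hc⟩ := hmem
  have hcx : x = f c + l (j 1) := by rw [hc, sub_add_cancel]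
  obtain ⟨m, rfl⟩ := exists_apply_one_eq_of_mem_injectiveTrace j hj
    (hC' ▸ Submodule.mem_top : c ∈ _)
  rw [hcx]
  exact apply_mem_injectiveTrace hinj (f ∘ₗ m + l) (j 1)
end

section
/- Let R be a commutative ring, I an injective R-module, and ι : R → I an injective R-linear map, and let J be an injective R-module. For every R-module A, the restriction map res : Hom_R(A, J) → Hom_R(s(A), J), sending f to its restriction to the submodule s(A), is surjective, and its kernel equals the trace Tr(I, Hom_R(A,J)) of the injective R-modules in Hom_R(A,J). Consequently Hom_R(s(A), J) is isomorphic to the cotorsion quotient q(Hom_R(A,J)). -/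
open scoped TensorProduct

universe u

/-- A linear map into an injective module extends along a linear map whose kernel it kills. -/
theorem Module.Injective.exists_comp_eq_of_ker_le {R : Type u} [Ring R]
    {J M N : Type u} [AddCommGroup J] [Module R J] [AddCommGroup M] [Module R M]
    [AddCommGroup N] [Module R N] (hJ : Module.Injective R J)
    (φ : M →ₗ[R] N) (f : M →ₗ[R] J) (hf : LinearMap.ker φ ≤ LinearMap.ker f) :
    ∃ g : N →ₗ[R] J, g ∘ₗ φ = f := by
  obtain ⟨g, hg⟩ := hJ.out ((LinearMap.ker φ).liftQ φ le_rfl)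
    (LinearMap.ker_eq_bot.mp (Submodule.ker_liftQ_eq_bot _ _ _ le_rfl))
    ((LinearMap.ker φ).liftQ f hf)
  exact ⟨g, LinearMap.ext fun m => by simpa using hg (Submodule.Quotient.mk m)⟩

/-- If `R` embeds in the injective module `I`, the maps `A → J` vanishing on the injective torsion
submodule of `A` are exactly those in the trace of the injectives, for `J` injective. -/
theorem ker_domRestrict'_eq_injectiveTrace {R : Type u} [CommRing R]
    {I : Type u} [AddCommGroup I] [Module R I]
    (hI : Module.Injective R I) (ι : R →ₗ[R] I) (hι : Function.Injective ι)
    (J : Type u) [AddCommGroup J] [Module R J] (hJ : Module.Injective R J)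
    (A : Type u) [AddCommGroup A] [Module R A] :
    LinearMap.ker
        (LinearMap.domRestrict' (M₂ := J)
          (LinearMap.ker ((TensorProduct.mk R A I).flip (ι 1)))) =
      injectiveTrace R (A →ₗ[R] J) := by
  apply le_antisymm
  · intro f hf
    obtain ⟨g, rfl⟩ := hJ.exists_comp_eq_of_ker_le ((TensorProduct.mk R A I).flip (ι 1)) f
      fun a ha => LinearMap.congr_fun (LinearMap.mem_ker.mp hf) ⟨a, ha⟩
    have hle : LinearMap.range ((TensorProduct.mk R A I).compr₂ g).flip ≤
        injectiveTrace R (A →ₗ[R] J) := le_sSup ⟨I, _, _, hI, _, rfl⟩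
    exact hle ⟨ι 1, rfl⟩
  · refine sSup_le ?_
    rintro _ ⟨K, _, _, hK, h, rfl⟩ _ ⟨x, rfl⟩
    obtain ⟨e, he⟩ := hK.out ι hι (LinearMap.toSpanSingleton R K x)
    have hx : e (ι 1) = x := by simpa using he 1
    refine LinearMap.mem_ker.mpr (LinearMap.ext fun a => ?_)
    have ha : (a : A) ⊗ₜ[R] ι 1 = 0 := a.2
    simpa [hx] using congrArg (TensorProduct.lift (h ∘ₗ e).flip) ha

/-- Let `I` be an injective module with an injective linear map `ι : R → I`, and let `J` be
an injective module.  For every module `A`, the restriction map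
`Hom_R(A, J) → Hom_R(s(A), J)` is surjective with kernel the trace of the injectives in
`Hom_R(A, J)`; consequently `Hom_R(s(A), J) ≅ q(Hom_R(A, J))`. -/
theorem hom_torsion_iso_cotorsion_hom
    {R : Type u} [CommRing R]
    {I : Type u} [AddCommGroup I] [Module R I]
    (hI : Module.Injective R I) (ι : R →ₗ[R] I) (hι : Function.Injective ι)
    (J : Type u) [AddCommGroup J] [Module R J] (hJ : Module.Injective R J)
    (A : Type u) [AddCommGroup A] [Module R A] :
    Function.Surjective
        (LinearMap.domRestrict' (M₂ := J)
          (LinearMap.ker ((TensorProduct.mk R A I).flip (ι 1)))) ∧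
      LinearMap.ker
          (LinearMap.domRestrict' (M₂ := J)
            (LinearMap.ker ((TensorProduct.mk R A I).flip (ι 1)))) =
        injectiveTrace R (A →ₗ[R] J) ∧
      Nonempty
        ((↥(LinearMap.ker ((TensorProduct.mk R A I).flip (ι 1))) →ₗ[R] J) ≃ₗ[R]
          ((A →ₗ[R] J) ⧸ injectiveTrace R (A →ₗ[R] J))) := by
  set S := LinearMap.ker ((TensorProduct.mk R A I).flip (ι 1))
  have hsurj : Function.Surjective (LinearMap.domRestrict' (M₂ := J) S) := fun f => by
    obtain ⟨g, hg⟩ := hJ.out S.subtype S.subtype_injective f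
    exact ⟨g, LinearMap.ext hg⟩
  have hker := ker_domRestrict'_eq_injectiveTrace hI ι hι J hJ A
  exact ⟨hsurj, hker, ⟨((Submodule.quotEquivOfEq _ _ hker.symm).trans
    (LinearMap.quotKerEquivOfSurjective _ hsurj)).symm⟩⟩
end
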